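/- Let n be a positive integer, s > 0, ρ ∈ (-1, 1), and let p be the variance-gamma density with parameters ν = (n-1)/2, α = n/(s(1-ρ²)), β = nρ/(s(1-ρ²)), μ = 0. Then for every real k > -1, ∫_ℝ |x|^k p(x) dx = ((2s/n)^k (1-ρ²)^{n/2+k} / (√π Γ(n/2))) · Γ((n+k)/2) Γ((k+1)/2) · ₂F₁((k+1)/2, (n+k)/2; 1/2; ρ²). -/

import Mathlib

open MeasureTheory Real Filter

/-- The modified Bessel function of the second kind `K_ν(x)`. -/
noncomputable def besselK (ν x : ℝ) : ℝ :=
  ∫ t in Set.Ioi (0 : ℝ), Real.exp (-x * Real.cosh t) * Real.cosh (ν * t)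

/-- The variance-gamma density with parameters `(ν, α, β, 0)`. -/
noncomputable def vgDensity (ν α β x : ℝ) : ℝ :=
  (α ^ 2 - β ^ 2) ^ (ν + 1/2) / (Real.sqrt π * (2 * α) ^ ν * Real.Gamma (ν + 1/2)) *
    (Real.exp (β * x) * |x| ^ ν * besselK ν (α * |x|))

/-- The ascending factorial `(u)_j = u (u+1) ⋯ (u+j-1)`. -/
noncomputable def ascFactorial (u : ℝ) (j : ℕ) : ℝ := ∏ i ∈ Finset.range j, (u + i)

/-- The Gaussian hypergeometric function `₂F₁(a, b; c; x)`. -/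
noncomputable def hyp2F1 (a b c x : ℝ) : ℝ :=
  ∑' j : ℕ, ascFactorial a j * ascFactorial b j / ascFactorial c j * x ^ j / (Nat.factorial j)


lemma aux_split (f : ℝ → ENNReal) (hf : Measurable f) :
    ∫⁻ x, f x = ∫⁻ x in Set.Ioi (0:ℝ), (f x + f (-x)) := by
  rw [lintegral_add_left hf, ← lintegral_add_compl f (measurableSet_Ioi (a := (0:ℝ)))]
  congr 1
  have h := (Measure.measurePreserving_neg (volume : Measure ℝ)).setLIntegral_comp_preimage
    (s := Set.Iio 0) measurableSet_Iio hf
  have h2 : (Neg.neg ⁻¹' Set.Iio (0:ℝ)) = Set.Ioi 0 := by ext; simp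
  rw [h2] at h
  rw [h, Set.compl_Ioi]
  exact (setLIntegral_congr Iio_ae_eq_Iic).symm

lemma aux_gam (m c : ℝ) (hm : 0 < m) (hc : 0 < c) :
    ∫⁻ x in Set.Ioi (0:ℝ), ENNReal.ofReal (x ^ (m-1) * exp (-(c * x))) =
      ENNReal.ofReal (c ^ (-m) * Gamma m) := by
  have h := Real.integral_rpow_mul_exp_neg_mul_Ioi hm hc
  have h1 : (1 / c) ^ m = c ^ (-m) := by
    rw [one_div, Real.inv_rpow hc.le, Real.rpow_neg hc.le]
  rw [h1] at h
  rw [← h, ofReal_integral_eq_lintegral_ofReal]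
  · apply Integrable.of_integral_ne_zero
    rw [h]
    have := Real.Gamma_pos_of_pos hm
    positivity
  · filter_upwards [self_mem_ae_restrict measurableSet_Ioi] with x hx
    have : (0:ℝ) < x := hx
    simp only [Pi.zero_apply]
    positivity

lemma aux_beta (a b : ℝ) (ha : 0 < a) (hb : 0 < b) :
    ∫⁻ v in Set.Ioi (0:ℝ), ENNReal.ofReal (v ^ (b-1) * ((1 + v) ^ (-(a+b)) * Gamma (a+b))) =
      ENNReal.ofReal (Gamma a * Gamma b) := by
  have hG := Real.Gamma_pos_of_pos hb
  calc _ = ∫⁻ v in Set.Ioi (0:ℝ), ∫⁻ p in Set.Ioi (0:ℝ),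
        ENNReal.ofReal (v ^ (b-1)) * ENNReal.ofReal (p ^ (a + b - 1) * exp (-((1 + v) * p))) := by
        apply setLIntegral_congr_fun measurableSet_Ioi
        intro v hv
        have hv : (0:ℝ) < v := hv
        simp only
        rw [lintegral_const_mul _ (by fun_prop), aux_gam _ _ (by linarith) (by linarith),
          ENNReal.ofReal_mul (by positivity)]
    _ = ∫⁻ p in Set.Ioi (0:ℝ), ∫⁻ v in Set.Ioi (0:ℝ), 
        ENNReal.ofReal (v ^ (b-1)) * ENNReal.ofReal (p ^ (a + b - 1) * exp (-((1 + v) * p))) := by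
        apply lintegral_lintegral_swap
        fun_prop
    _ = ∫⁻ p in Set.Ioi (0:ℝ), ENNReal.ofReal (p ^ (a-1) * exp (-(1 * p))) * 
          ENNReal.ofReal (Gamma b) := by
        apply setLIntegral_congr_fun measurableSet_Ioi
        intro p hp
        have hp : (0:ℝ) < p := hp
        simp only
        have : ∀ v ∈ Set.Ioi (0:ℝ), ENNReal.ofReal (v ^ (b-1)) * 
            ENNReal.ofReal (p ^ (a + b - 1) * exp (-((1 + v) * p))) =
            ENNReal.ofReal (p ^ (a + b - 1) * exp (-p)) * 
              ENNReal.ofReal (v ^ (b-1) * exp (-(p * v))) := by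
          intro v hv
          have hv : (0:ℝ) < v := hv
          rw [← ENNReal.ofReal_mul (by positivity), ← ENNReal.ofReal_mul (by positivity)]
          congr 1
          rw [show -((1 + v) * p) = -p + -(p * v) by ring, exp_add]
          ring
        rw [setLIntegral_congr_fun measurableSet_Ioi this, lintegral_const_mul _ (by fun_prop),
          aux_gam _ _ hb hp, ← ENNReal.ofReal_mul (by positivity), 
          ← ENNReal.ofReal_mul (by positivity)]
        congr 1
        rw [show a - 1 = (a + b - 1) + (-b) by ring, Real.rpow_add hp]
        ring_nf
    _ = _ := by
        rw [lintegral_mul_const _ (by fun_prop), aux_gam _ _ ha one_pos, 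
          ← ENNReal.ofReal_mul (by have := Real.Gamma_pos_of_pos ha; positivity)]
        simp

lemma aux_cosh (a b : ℝ) (ha : 0 < a) (hb : 0 < b) :
    ∫⁻ t in Set.Ioi (0:ℝ), ENNReal.ofReal (cosh ((b-a) * t) * (cosh t ^ (-(a+b)) * Gamma (a+b))) =
      ENNReal.ofReal (2 ^ (a+b-2) * (Gamma a * Gamma b)) := by
  have hG := Real.Gamma_pos_of_pos (add_pos ha hb)
  have key := lintegral_image_eq_lintegral_abs_deriv_mul (s := Set.univ) 
    (f := fun t : ℝ => exp (2 * t)) (f' := fun t => 2 * exp (2 * t)) MeasurableSet.univ 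
    (fun t _ => by
      have := ((hasDerivAt_id t).const_mul 2).exp
      simp only [id, mul_one] at this
      rw [mul_comm]
      exact this.hasDerivWithinAt) 
    (fun x _ y _ h => by simpa using h)
    (fun v => ENNReal.ofReal (v ^ (b-1) * ((1 + v) ^ (-(a+b)) * Gamma (a+b))))
  have himg : (fun t : ℝ => exp (2 * t)) '' Set.univ = Set.Ioi 0 := by
    ext y
    simp only [Set.image_univ, Set.mem_range, Set.mem_Ioi]
    constructor
    · rintro ⟨t, rfl⟩; positivity
    · intro hy
      exact ⟨log y / 2, by rw [mul_div_cancel₀ _ two_ne_zero, exp_log hy]⟩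
  rw [himg, aux_beta a b ha hb, Measure.restrict_univ] at key
  have h1 : ∀ t : ℝ, ENNReal.ofReal |2 * exp (2 * t)| * 
      ENNReal.ofReal (exp (2*t) ^ (b-1) * ((1 + exp (2*t)) ^ (-(a+b)) * Gamma (a+b))) =
      ENNReal.ofReal (2 ^ (1 - (a+b)) * (exp ((b-a) * t) * (cosh t ^ (-(a+b)) * Gamma (a+b)))) := by
    intro t
    have hc := cosh_pos t
    rw [abs_of_pos (by positivity), ← ENNReal.ofReal_mul (by positivity)]
    congr 1
    have : 1 + exp (2 * t) = 2 * exp t * cosh t := by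
      rw [cosh_eq]
      have : exp t * exp (-t) = 1 := by rw [← exp_add]; simp
      rw [two_mul t, exp_add]
      linear_combination -this
    rw [this, mul_rpow (by positivity) hc.le, mul_rpow (by positivity) (by positivity),
      ← exp_mul, ← exp_mul, show (1:ℝ) - (a+b) = 1 + -(a+b) by ring, Real.rpow_add two_pos, 
      Real.rpow_one, show (b-a)*t = 2 * t + 2 * t * (b-1) + t * -(a+b) by ring, exp_add, exp_add]
    ring
  simp_rw [h1] at key
  rw [aux_split _ (by fun_prop)] at key
  have h2 : ∀ t ∈ Set.Ioi (0:ℝ), 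
     ENNReal.ofReal (2 ^ (1 - (a+b)) * (exp ((b-a) * t) * (cosh t ^ (-(a+b)) * Gamma (a+b)))) +
     ENNReal.ofReal (2 ^ (1 - (a+b)) * (exp ((b-a) * -t) * (cosh (-t) ^ (-(a+b)) * Gamma (a+b)))) 
     = ENNReal.ofReal (2 ^ (2 - (a+b))) * 
       ENNReal.ofReal (cosh ((b-a) * t) * (cosh t ^ (-(a+b)) * Gamma (a+b))) := by
    intro t _
    have hc := cosh_pos t
    rw [cosh_neg, ← ENNReal.ofReal_add (by positivity) (by positivity), 
      ← ENNReal.ofReal_mul (by positivity)]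
    congr 1
    rw [cosh_eq ((b-a)*t), show (2:ℝ) - (a+b) = 1 + (1 -(a+b)) by ring, 
      Real.rpow_add two_pos 1, Real.rpow_one]
    ring_nf
  rw [setLIntegral_congr_fun measurableSet_Ioi h2, lintegral_const_mul _ (by fun_prop)] at key
  rw [ENNReal.ofReal_mul (by positivity), key, ← mul_assoc, ← ENNReal.ofReal_mul (by positivity),
    ← Real.rpow_add two_pos]
  simp

lemma meas_besselK (ν : ℝ) : Measurable (besselK ν) := by
  have : StronglyMeasurable (fun p : ℝ × ℝ => exp (-p.1 * cosh p.2) * cosh (ν * p.2)) := by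
    apply Measurable.stronglyMeasurable
    fun_prop
  exact (this.integral_prod_right' (ν := volume.restrict (Set.Ioi 0))).measurable

lemma besselK_nonneg (ν x : ℝ) : 0 ≤ besselK ν x := by
  unfold besselK
  apply integral_nonneg
  intro t
  have := cosh_pos (ν * t)
  simp only [Pi.zero_apply]
  positivity

lemma aux_mellin (a b α : ℝ) (ha : 0 < a) (hb : 0 < b) (hα : 0 < α) :
    ∫⁻ x in Set.Ioi (0:ℝ), ENNReal.ofReal (x ^ (a+b-1) * besselK (b-a) (α * x)) =
      ENNReal.ofReal (α ^ (-(a+b)) * (2 ^ (a+b-2) * (Gamma a * Gamma b))) := by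
  have hI : ∫⁻ x in Set.Ioi (0:ℝ), ∫⁻ t in Set.Ioi (0:ℝ), ENNReal.ofReal (x ^ (a+b-1)) *
      ENNReal.ofReal (exp (-(α * x) * cosh t) * cosh ((b-a) * t)) = 
      ENNReal.ofReal (α ^ (-(a+b)) * (2 ^ (a+b-2) * (Gamma a * Gamma b))) := by
    rw [lintegral_lintegral_swap (by fun_prop), ENNReal.ofReal_mul (by positivity), 
      ← aux_cosh a b ha hb, ← lintegral_const_mul _ (by fun_prop)]
    apply setLIntegral_congr_fun measurableSet_Ioi
    intro t _
    have hc := cosh_pos t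
    have hc' := cosh_pos ((b-a)*t)
    simp only
    have : ∀ x ∈ Set.Ioi (0:ℝ), ENNReal.ofReal (x ^ (a+b-1)) *
      ENNReal.ofReal (exp (-(α * x) * cosh t) * cosh ((b-a) * t)) = 
      ENNReal.ofReal (cosh ((b-a)*t)) * 
        ENNReal.ofReal (x ^ (a+b-1) * exp (-((α * cosh t) * x))) := by
      intro x hx
      have hx : (0:ℝ) < x := hx
      rw [← ENNReal.ofReal_mul (by positivity), ← ENNReal.ofReal_mul (by positivity)]
      congr 1
      ring_nf
    rw [setLIntegral_congr_fun measurableSet_Ioi this, lintegral_const_mul _ (by fun_prop),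
      aux_gam _ _ (by linarith) (by positivity), mul_rpow hα.le hc.le,
      ← ENNReal.ofReal_mul (by positivity), ← ENNReal.ofReal_mul (by positivity)]
    congr 1
    ring
  have hfin := ae_lt_top (μ := volume.restrict (Set.Ioi (0:ℝ))) 
    (f := fun x => ∫⁻ t in Set.Ioi (0:ℝ), ENNReal.ofReal (x ^ (a+b-1)) *
      ENNReal.ofReal (exp (-(α * x) * cosh t) * cosh ((b-a) * t))) 
    (by apply Measurable.lintegral_prod_right'
          (f := fun p : ℝ × ℝ => ENNReal.ofReal (p.1 ^ (a+b-1)) *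
            ENNReal.ofReal (exp (-(α * p.1) * cosh p.2) * cosh ((b-a) * p.2)))
        fun_prop) (by rw [hI]; exact ENNReal.ofReal_ne_top)
  rw [← hI]
  apply lintegral_congr_ae
  filter_upwards [hfin, self_mem_ae_restrict measurableSet_Ioi] with x hx hx0
  have hx0 : (0:ℝ) < x := hx0
  rw [lintegral_const_mul _ (by fun_prop)] at hx ⊢
  rw [ENNReal.ofReal_mul (by positivity)]
  congr 1
  have hne : ENNReal.ofReal (x ^ (a+b-1)) ≠ 0 := by
    simp only [ne_eq, ENNReal.ofReal_eq_zero, not_le]; positivity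
  have hx2 := ENNReal.lt_top_of_mul_ne_top_right hx.ne hne
  unfold besselK
  rw [integral_eq_lintegral_of_nonneg_ae, ENNReal.ofReal_toReal hx2.ne]
  · filter_upwards with t
    have := cosh_pos ((b-a) * t)
    simp only [Pi.zero_apply]
    positivity
  · apply Measurable.aestronglyMeasurable
    fun_prop

lemma Gamma_asc (u : ℝ) (hu : 0 < u) (j : ℕ) : Gamma (u + j) = ascFactorial u j * Gamma u := by
  induction j with
  | zero => simp [ascFactorial]
  | succ j ih =>
    rw [Nat.cast_succ, ← add_assoc, Real.Gamma_add_one (by positivity), ih]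
    simp only [ascFactorial, Finset.prod_range_succ]
    ring

lemma fact_asc (j : ℕ) : ((2*j).factorial : ℝ) = 4 ^ j * j.factorial * ascFactorial (1/2) j := by
  induction j with
  | zero => simp [ascFactorial]
  | succ j ih =>
    rw [show 2 * (j+1) = 2 * j + 1 + 1 by ring, Nat.factorial_succ, Nat.factorial_succ, 
      Nat.factorial_succ]
    push_cast
    rw [ih]
    simp only [ascFactorial, Finset.prod_range_succ]
    ring

lemma asc_pos (u : ℝ) (hu : 0 < u) (j : ℕ) : 0 < ascFactorial u j := by
  apply Finset.prod_pos
  intro i _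
  positivity

lemma aux_main (a ν α β C k : ℝ) (ha : a = (k+1)/2) (hk : -1 < k) (hν : 0 < a + ν) (hα : 0 < α)
    (hC : 0 ≤ C) :
    ∫ x : ℝ, |x| ^ k * (C * (exp (β * x) * |x| ^ ν * besselK ν (α * |x|))) =
      C * 2 ^ (k + ν) * α ^ (-(k + ν + 1)) * Gamma a * Gamma (a + ν) *
        hyp2F1 a (a + ν) (1/2) ((β/α)^2) := by
  have ha0 : 0 < a := by rw [ha]; linarith
  have hK := meas_besselK ν
  rw [integral_eq_lintegral_of_nonneg_ae]
  rotate_left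
  · filter_upwards with x
    have := besselK_nonneg ν (α * |x|)
    simp only [Pi.zero_apply]
    positivity
  · apply Measurable.aestronglyMeasurable
    fun_prop
  rw [aux_split _ (by fun_prop)]
  have h1 : ∀ x ∈ Set.Ioi (0:ℝ), 
      ENNReal.ofReal (|x| ^ k * (C * (exp (β * x) * |x| ^ ν * besselK ν (α * |x|)))) +
      ENNReal.ofReal (|-x| ^ k * (C * (exp (β * -x) * |-x| ^ ν * besselK ν (α * |-x|)))) =
      ∑' j : ℕ, ENNReal.ofReal (2 * C * β ^ (2*j) / (2*j).factorial) * 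
        ENNReal.ofReal (x ^ ((a + j) + (a + ν + j) - 1) * 
          besselK ((a + ν + j) - (a + j)) (α * x)) := by
    intro x hx
    have hx : (0:ℝ) < x := hx
    have hKx := besselK_nonneg ν (α * x)
    rw [abs_neg, abs_of_pos hx, ← ENNReal.ofReal_add (by positivity) (by positivity)]
    have hs := (Real.hasSum_cosh (β * x)).mul_left (2 * C * x ^ (k + ν) * besselK ν (α * x))
    have hb : ∀ j : ℕ, 0 ≤ β ^ (2*j) := fun j => by rw [pow_mul]; positivity
    have hbx : ∀ j : ℕ, 0 ≤ (β * x) ^ (2*j) := fun j => by rw [pow_mul]; positivity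
    trans ENNReal.ofReal (2 * C * x ^ (k + ν) * besselK ν (α * x) * cosh (β * x))
    · congr 1
      rw [cosh_eq, Real.rpow_add hx]
      ring_nf
    · rw [← hs.tsum_eq, ENNReal.ofReal_tsum_of_nonneg _ hs.summable]
      · congr 1
        ext j
        rw [← ENNReal.ofReal_mul (by have := hb j; positivity)]
        congr 1
        rw [show (a + ν + j) - (a + j) = ν by ring, 
          show (a + j) + (a + ν + j) - 1 = (k + ν) + ((2 * j : ℕ) : ℝ) by rw [ha]; push_cast; ring,
          Real.rpow_add hx (k + ν), Real.rpow_natCast, mul_pow]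
        ring
      · intro j
        have := hbx j
        positivity
  rw [setLIntegral_congr_fun measurableSet_Ioi h1, lintegral_tsum (fun j => by
    have := meas_besselK ((a + ν + j) - (a + j))
    fun_prop), ENNReal.tsum_toReal_eq]
  · unfold hyp2F1
    rw [← tsum_mul_left]
    congr 1
    ext j
    have hb : 0 ≤ β ^ (2*j) := by rw [pow_mul]; positivity
    have hg1 := Real.Gamma_pos_of_pos (show 0 < a + j by positivity)
    have hg2 := Real.Gamma_pos_of_pos (show 0 < a + ν + j by positivity)
    rw [lintegral_const_mul _ (by
      have := meas_besselK ((a + ν + j) - (a + j))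
      fun_prop), aux_mellin _ _ _ (by positivity) (by positivity) hα, 
      ← ENNReal.ofReal_mul (by positivity), ENNReal.toReal_ofReal (by positivity),
      Gamma_asc _ ha0, Gamma_asc _ hν, fact_asc]
    have hp := asc_pos (1/2) (by norm_num) j
    rw [show -(a + j + (a + ν + j)) = -(k + ν + 1) + -((2 * j : ℕ) : ℝ) by rw [ha]; push_cast; ring,
      show a + j + (a + ν + j) - 2 = k + ν + ((2 * j : ℕ) : ℝ) + (-1) by rw [ha]; push_cast; ring,
      Real.rpow_add hα, Real.rpow_add two_pos, Real.rpow_add two_pos, Real.rpow_neg hα.le (((2 * j : ℕ) : ℝ)),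
      Real.rpow_natCast, Real.rpow_natCast, Real.rpow_neg_one, ← pow_mul, div_pow, pow_mul 2 2 j]
    norm_num
    field_simp
  · intro j
    rw [lintegral_const_mul _ (by
      have := meas_besselK ((a + ν + j) - (a + j))
      fun_prop), aux_mellin _ _ _ (by positivity) (by positivity) hα]
    exact ENNReal.mul_ne_top ENNReal.ofReal_ne_top ENNReal.ofReal_ne_top

theorem normal_product_mean_abs_moment (n : ℕ) (hn : 0 < n) (s ρ : ℝ) (hs : 0 < s)
    (hρ : ρ ∈ Set.Ioo (-1 : ℝ) 1) (k : ℝ) (hk : k > -1) :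
    ∫ x : ℝ, |x| ^ k *
        vgDensity (((n : ℝ) - 1)/2) ((n : ℝ)/(s * (1 - ρ ^ 2))) ((n : ℝ) * ρ/(s * (1 - ρ ^ 2))) x =
      (2 * s / (n : ℝ)) ^ k * (1 - ρ ^ 2) ^ ((n : ℝ)/2 + k) /
          (Real.sqrt π * Real.Gamma ((n : ℝ)/2)) *
        Real.Gamma (((n : ℝ) + k)/2) * Real.Gamma ((k + 1)/2) *
        hyp2F1 ((k + 1)/2) (((n : ℝ) + k)/2) (1/2) (ρ ^ 2) := by
  have hn1 : (1:ℝ) ≤ n := by exact_mod_cast hn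
  have hn0 : (0:ℝ) < n := by linarith
  have hq : 0 < 1 - ρ ^ 2 := by nlinarith [hρ.1, hρ.2]
  set q := 1 - ρ ^ 2 with hqdef
  have hα : 0 < (n:ℝ) / (s * q) := by positivity
  have hdiff : ((n : ℝ)/(s * q))^2 - ((n : ℝ) * ρ/(s * q))^2 = ((n:ℝ)/(s * q))^2 * q := by
    rw [hqdef]; ring
  have hG : 0 < Gamma ((n:ℝ)/2) := Real.Gamma_pos_of_pos (by positivity)
  have hν : ((n:ℝ) - 1)/2 + 1/2 = n/2 := by ring
  simp only [vgDensity]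
  rw [hdiff, hν]
  rw [aux_main ((k+1)/2) _ _ _ _ k rfl hk (by linarith) hα (by positivity)]
  have e1 : (n:ℝ) * ρ / (s * q) / (n / (s * q)) = ρ := by field_simp
  have e2 : (k+1)/2 + ((n:ℝ) - 1)/2 = (n + k)/2 := by ring
  rw [e1, e2]
  have e3 : 2 * s / (n:ℝ) = 2 * ((n:ℝ) / (s * q))⁻¹ * q⁻¹ := by field_simp
  rw [e3]
  generalize (n:ℝ) / (s * q) = α at *
  have e4 : (α ^ 2 * q) ^ ((n:ℝ)/2) / (√π * (2 * α) ^ (((n:ℝ) - 1)/2) * Gamma ((n:ℝ)/2)) * 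
      2 ^ (k + ((n:ℝ)-1)/2) * α ^ (-(k + ((n:ℝ)-1)/2 + 1)) = 
      (2 * α⁻¹ * q⁻¹) ^ k * q ^ ((n:ℝ)/2 + k) / (√π * Gamma ((n:ℝ)/2)) := by
    rw [mul_rpow (by positivity) hq.le, mul_rpow (by positivity) hα.le, 
      mul_rpow (by positivity) (by positivity), mul_rpow (by positivity) (by positivity),
      inv_rpow hα.le, inv_rpow hq.le, Real.rpow_add two_pos, Real.rpow_add hq,
      ← Real.rpow_natCast α 2, ← Real.rpow_mul hα.le, Real.rpow_neg hα.le,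
      show (((2:ℕ):ℝ) * ((n:ℝ)/2)) = ((n:ℝ)-1)/2 + ((n:ℝ)-1)/2 + 1 by push_cast; ring,
      Real.rpow_add hα _ 1, Real.rpow_add hα _ 1, Real.rpow_add hα, Real.rpow_add hα]
    field_simp
  rw [e4]
  ring
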